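/- Let a, b ∈ [0,1] with a ≠ b, let f be the infinite product on Ω^∞ of Bernoulli(a) measures and g the infinite product of Bernoulli(b) measures. Then f({ω : lim_{t→∞} D_t(ω,f,g) = 1}) = 1 and g({ω : lim_{t→∞} D_t(ω,f,g) = 1}) = 0; consequently the finite derivative test D is ideal with respect to the set of all i.i.d. (infinite product Bernoulli) probability measures on Ω^∞. -/

import Mathlib

open MeasureTheory Filter Set
open scoped ENNReal

/-- The space Ω^∞ of infinite binary sequences. -/
abbrev BinSeq : Type := ℕ → Bool

/-- The cylinder set `[ω^t]` of sequences agreeing with `ω` in the first `t` coordinates. -/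
def cyl (ω : BinSeq) (t : ℕ) : Set BinSeq := {ω' | ∀ i < t, ω' i = ω i}

/-- A (candidate) cardinal comparison test: to each ordered pair of measures, each time `t`
and each realization `ω` it assigns a number. -/
abbrev Test : Type := Measure BinSeq → Measure BinSeq → ℕ → BinSeq → ℝ

/-- The σ-algebra on `BinSeq` generated by the first `t` coordinates. -/
def coordAlg (t : ℕ) : MeasurableSpace BinSeq :=
  MeasurableSpace.comap (fun ω (i : Fin t) => ω (i : ℕ)) inferInstance

/-- A cardinal comparison test: values in `[0,1]`, and `T_t` is measurable with respect to the
σ-algebra generated by the first `t` coordinates, for every `t ≥ 1`. -/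
def IsCCTest (T : Test) : Prop :=
  ∀ f g : Measure BinSeq, IsProbabilityMeasure f → IsProbabilityMeasure g →
    ∀ t : ℕ, 1 ≤ t →
      (∀ ω, T f g t ω ∈ Set.Icc (0:ℝ) 1) ∧ @Measurable BinSeq ℝ (coordAlg t) _ (T f g t)

/-- `L_{T,ε}^{(f,g)}`: the set of `ω` where `lim_t T_t(ω,f,g)` exists and is `> ε`. -/
def LSet (T : Test) (f g : Measure BinSeq) (ε : ℝ) : Set BinSeq :=
  {ω | ∃ l : ℝ, Tendsto (fun t => T f g t ω) atTop (nhds l) ∧ ε < l}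

/-- `R_{T,ε}^{(f,g)}`: the set of `ω` where `lim_t T_t(ω,f,g)` exists and is `< ε`. -/
def RSet (T : Test) (f g : Measure BinSeq) (ε : ℝ) : Set BinSeq :=
  {ω | ∃ l : ℝ, Tendsto (fun t => T f g t ω) atTop (nhds l) ∧ l < ε}

/-- Anonymity: `T_t(ω,f,g) = 1 - T_t(ω,g,f)`. -/
def Anonymous (T : Test) : Prop :=
  ∀ f g : Measure BinSeq, IsProbabilityMeasure f → IsProbabilityMeasure g →
    ∀ t : ℕ, 1 ≤ t → ∀ ω, T f g t ω = 1 - T g f t ω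

/-- Error-freeness. -/
def ErrorFree (T : Test) : Prop :=
  ∀ f g : Measure BinSeq, IsProbabilityMeasure f → IsProbabilityMeasure g →
    ∀ A : Set BinSeq, MeasurableSet A →
      (∀ ε : ℝ, ε ∈ Set.Ioo 0 (1/2) →
        f (A ∩ RSet T f g ε) ≤ ENNReal.ofReal (ε / (1 - ε)) * g (A ∩ RSet T f g ε)) ∧
      (∀ ε : ℝ, ε ∈ Set.Ioo (1/2) 1 →
        g (A ∩ LSet T f g ε) ≤ ENNReal.ofReal ((1 - ε) / ε) * f (A ∩ LSet T f g ε))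

/-- Reasonableness. -/
def Reasonable (T : Test) : Prop :=
  ∀ f g : Measure BinSeq, IsProbabilityMeasure f → IsProbabilityMeasure g →
    ∀ A : Set BinSeq, MeasurableSet A →
      (∀ ε : ℝ, ε ∈ Set.Ioo 0 (1/2) →
        0 < g A → f A < ENNReal.ofReal (ε / (1 - ε)) * g A →
          0 < g (A ∩ RSet T f g ε)) ∧
      (∀ ε : ℝ, ε ∈ Set.Ioo (1/2) 1 →
        0 < f A → g A < ENNReal.ofReal ((1 - ε) / ε) * f A →
          0 < f (A ∩ LSet T f g ε))

/-- The finite derivative test `D`. -/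
noncomputable def Dtest : Test := fun f g t ω =>
  match t with
  | 0 => 1/2
  | Nat.succ s =>
      if 0 < f (cyl ω s) + g (cyl ω s) then
        (f (cyl ω s)).toReal / ((f (cyl ω s)).toReal + (g (cyl ω s)).toReal)
      else 1/2


/-- `μ` is the infinite product of Bernoulli(`p`) measures: a probability measure whose value
on every cylinder is the corresponding product of `p`'s and `(1-p)`'s. -/
def IsBernoulliProduct (μ : Measure BinSeq) (p : ℝ) : Prop :=
  IsProbabilityMeasure μ ∧ p ∈ Set.Icc (0:ℝ) 1 ∧
    ∀ (ω : BinSeq) (t : ℕ),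
      μ (cyl ω t) = ∏ i ∈ Finset.range t,
        (if ω i then ENNReal.ofReal p else ENNReal.ofReal (1 - p))

/-- A test is ideal with respect to a set `𝒜` of measures. -/
def IdealWrt (T : Test) (𝒜 : Set (Measure BinSeq)) : Prop :=
  ∀ f g : Measure BinSeq, f ∈ 𝒜 → g ∈ 𝒜 → f ≠ g →
    f {ω | Tendsto (fun t => T f g t ω) atTop (nhds 1)} = 1 ∧
    g {ω | Tendsto (fun t => T f g t ω) atTop (nhds 0)} = 1

/-- The mass that a Bernoulli(`p`) measure gives to the outcome `x`. -/
noncomputable def bernoulliMass (p : ℝ) (x : Bool) : ℝ := if x then p else 1 - p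

lemma bernoulliMass_nonneg {p : ℝ} (hp : p ∈ Set.Icc (0:ℝ) 1) (x : Bool) :
    0 ≤ bernoulliMass p x := by
  cases x <;> simp [bernoulliMass, hp.1, hp.2]

/-- Square root of the one-coordinate likelihood ratio of Bernoulli(`q`) against
Bernoulli(`p`). -/
noncomputable def sqrtRatio (p q : ℝ) (x : Bool) : ℝ :=
  √(bernoulliMass q x / bernoulliMass p x)

lemma sqrtRatio_nonneg (p q : ℝ) (x : Bool) : 0 ≤ sqrtRatio p q x := Real.sqrt_nonneg _

lemma sqrtRatio_mul_bernoulliMass {p : ℝ} (q : ℝ) (hp : p ∈ Set.Icc (0:ℝ) 1) (x : Bool) :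
    sqrtRatio p q x * bernoulliMass p x = √(bernoulliMass q x * bernoulliMass p x) := by
  have h := bernoulliMass_nonneg hp x
  rcases h.eq_or_lt with h0 | h0
  · simp [← h0]
  · rw [sqrtRatio, ← Real.sqrt_sq h, ← Real.sqrt_mul' _ (sq_nonneg _), Real.sqrt_sq h]
    congr 1
    field_simp

lemma sqrt_mul_le_half_add {x y : ℝ} (hx : 0 ≤ x) (hy : 0 ≤ y) : √(x * y) ≤ (x + y) / 2 := by
  rw [Real.sqrt_le_left (by positivity)]
  nlinarith [sq_nonneg (x - y)]

lemma sqrt_mul_lt_half_add {x y : ℝ} (hx : 0 ≤ x) (hy : 0 ≤ y) (hxy : x ≠ y) :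
    √(x * y) < (x + y) / 2 := by
  have hsq : 0 < (x - y) ^ 2 := by have := sub_ne_zero.2 hxy; positivity
  have hpos : 0 < (x + y) / 2 := by
    rcases hx.eq_or_lt with rfl | h
    · have := lt_of_le_of_ne hy hxy
      linarith
    · linarith
  rw [Real.sqrt_lt' hpos]
  nlinarith

/-- The Hellinger affinity of two distinct Bernoulli measures is less than `1`. -/
lemma sum_sqrtRatio_mul_bernoulliMass_lt_one {p q : ℝ} (hp : p ∈ Set.Icc (0:ℝ) 1)
    (hq : q ∈ Set.Icc (0:ℝ) 1) (hpq : p ≠ q) :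
    ∑ x, sqrtRatio p q x * bernoulliMass p x < 1 := by
  have h₁ := sqrt_mul_lt_half_add hq.1 hp.1 hpq.symm
  have h₂ := sqrt_mul_le_half_add (sub_nonneg.2 hq.2) (sub_nonneg.2 hp.2)
  simp only [sqrtRatio_mul_bernoulliMass q hp, Fintype.sum_bool]
  simp only [bernoulliMass, if_true, Bool.false_eq_true, if_false]
  linarith

lemma mem_cyl_self (ω : BinSeq) (t : ℕ) : ω ∈ cyl ω t := fun _ _ => rfl

lemma cyl_eq_of_mem {ω ω' : BinSeq} {t : ℕ} (h : ω' ∈ cyl ω t) : cyl ω' t = cyl ω t := by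
  ext x
  exact ⟨fun hx i hi => (hx i hi).trans (h i hi), fun hx i hi => (hx i hi).trans (h i hi).symm⟩

lemma measurableSet_cyl (ω : BinSeq) (t : ℕ) : MeasurableSet (cyl ω t) := by
  have : cyl ω t = ⋂ i, ⋂ (_ : i < t), (fun x : BinSeq => x i) ⁻¹' {ω i} := by
    ext x; simp [cyl]
  rw [this]
  exact .iInter fun i => .iInter fun _ => measurable_pi_apply i (measurableSet_singleton _)

/-- Extension of a finite binary word by `false`. -/
def extendWord {t : ℕ} (x : Fin t → Bool) : BinSeq :=
  fun j => if h : j < t then x ⟨j, h⟩ else false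

@[simp] lemma extendWord_apply {t : ℕ} (x : Fin t → Bool) (i : Fin t) :
    extendWord x i = x i := by
  simp [extendWord]

lemma restrict_preimage_singleton {t : ℕ} (x : Fin t → Bool) :
    (fun (ω : BinSeq) (i : Fin t) => ω i) ⁻¹' {x} = cyl (extendWord x) t := by
  ext ω
  simp only [mem_preimage, mem_singleton_iff, cyl, mem_ofPred_eq, funext_iff]
  refine ⟨fun h i hi => ?_, fun h i => ?_⟩
  · rw [h ⟨i, hi⟩]
    exact (extendWord_apply x ⟨i, hi⟩).symm
  · rw [h i i.2, extendWord_apply]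

namespace IsBernoulliProduct

variable {μ ν : Measure BinSeq} {p q : ℝ}

lemma measure_cyl (hμ : IsBernoulliProduct μ p) (ω : BinSeq) (t : ℕ) :
    μ (cyl ω t) = ENNReal.ofReal (∏ i ∈ Finset.range t, bernoulliMass p (ω i)) := by
  rw [hμ.2.2, ENNReal.ofReal_prod_of_nonneg fun i _ => bernoulliMass_nonneg hμ.2.1 _]
  refine Finset.prod_congr rfl fun i _ => ?_
  cases ω i <;> simp [bernoulliMass]

lemma toReal_measure_cyl (hμ : IsBernoulliProduct μ p) (ω : BinSeq) (t : ℕ) :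
    (μ (cyl ω t)).toReal = ∏ i ∈ Finset.range t, bernoulliMass p (ω i) := by
  rw [hμ.measure_cyl, ENNReal.toReal_ofReal]
  exact Finset.prod_nonneg fun i _ => bernoulliMass_nonneg hμ.2.1 _

lemma lintegral_prod (hμ : IsBernoulliProduct μ p) {r : Bool → ℝ} (hr : ∀ x, 0 ≤ r x) (t : ℕ) :
    ∫⁻ ω, ENNReal.ofReal (∏ i ∈ Finset.range t, r (ω i)) ∂μ =
      ENNReal.ofReal (∑ x, r x * bernoulliMass p x) ^ t := by
  have hmass := bernoulliMass_nonneg hμ.2.1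
  have hmeas : Measurable (fun (ω : BinSeq) (i : Fin t) => ω i) :=
    measurable_pi_lambda _ fun i => measurable_pi_apply _
  have hmap : ∫⁻ ω, ENNReal.ofReal (∏ i ∈ Finset.range t, r (ω i)) ∂μ =
      ∫⁻ x, ENNReal.ofReal (∏ i, r (x i)) ∂(μ.map fun ω (i : Fin t) => ω i) := by
    rw [lintegral_map (measurable_of_countable _) hmeas]
    simp only [Finset.prod_range]
  rw [hmap, lintegral_fintype, ← ENNReal.ofReal_pow
    (Finset.sum_nonneg fun x _ => mul_nonneg (hr x) (hmass x)), Fintype.sum_pow,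
    ENNReal.ofReal_sum_of_nonneg
      fun x _ => Finset.prod_nonneg fun i _ => mul_nonneg (hr _) (hmass _)]
  refine Finset.sum_congr rfl fun x _ => ?_
  rw [Measure.map_apply hmeas (measurableSet_singleton _), restrict_preimage_singleton,
    hμ.measure_cyl, ← ENNReal.ofReal_mul (Finset.prod_nonneg fun i _ => hr _), Finset.prod_range,
    Finset.prod_mul_distrib]
  simp only [extendWord_apply]

lemma ae_bernoulliMass_pos (hμ : IsBernoulliProduct μ p) :
    ∀ᵐ ω ∂μ, ∀ i, 0 < bernoulliMass p (ω i) := by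
  rw [ae_all_iff]
  intro i
  have h : ∀ x : Fin (i + 1) → Bool, ∀ᵐ ω ∂μ,
      ω ∈ cyl (extendWord x) (i + 1) → 0 < bernoulliMass p (ω i) := by
    intro x
    rcases (bernoulliMass_nonneg hμ.2.1 (extendWord x i)).eq_or_lt with h0 | h0
    · have hz : μ (cyl (extendWord x) (i + 1)) = 0 := by
        rw [hμ.measure_cyl, Finset.prod_range_succ, ← h0, mul_zero, ENNReal.ofReal_zero]
      filter_upwards [measure_eq_zero_iff_ae_notMem.1 hz] with ω hω hmem
      exact absurd hmem hω
    · refine .of_forall fun ω hω => ?_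
      rwa [hω i i.lt_succ_self]
  filter_upwards [ae_all_iff.2 h] with ω hω
  refine hω (fun j => ω j) ?_
  rw [← restrict_preimage_singleton]
  rfl

lemma ae_tendsto_prod_sqrtRatio (hμ : IsBernoulliProduct μ p) (hq : q ∈ Set.Icc (0:ℝ) 1)
    (hpq : p ≠ q) :
    ∀ᵐ ω ∂μ, Tendsto (fun t => ∏ i ∈ Finset.range t, sqrtRatio p q (ω i)) atTop (nhds 0) := by
  have hmeas : ∀ t : ℕ, Measurable fun ω : BinSeq =>
      ENNReal.ofReal (∏ i ∈ Finset.range t, sqrtRatio p q (ω i)) := fun t =>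
    (Finset.measurable_fun_prod _ fun i _ =>
      (measurable_of_countable (sqrtRatio p q)).comp (measurable_pi_apply i)).ennreal_ofReal
  have hfin : ∫⁻ ω, ∑' t, ENNReal.ofReal (∏ i ∈ Finset.range t, sqrtRatio p q (ω i)) ∂μ ≠ ⊤ := by
    rw [lintegral_tsum fun t => (hmeas t).aemeasurable]
    simp only [hμ.lintegral_prod (sqrtRatio_nonneg p q), ENNReal.tsum_geometric]
    refine ENNReal.inv_ne_top.2 (tsub_pos_of_lt ?_).ne'
    exact ENNReal.ofReal_lt_one.2 (sum_sqrtRatio_mul_bernoulliMass_lt_one hμ.2.1 hq hpq)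
  filter_upwards [ae_lt_top (.tsum hmeas) hfin] with ω hω
  have h := (ENNReal.tendsto_toReal ENNReal.zero_ne_top).comp
    (ENNReal.tendsto_atTop_zero_of_tsum_ne_top hω.ne)
  refine h.congr fun t => ?_
  exact ENNReal.toReal_ofReal (Finset.prod_nonneg fun i _ => sqrtRatio_nonneg p q _)

lemma ae_tendsto_Dtest (hμ : IsBernoulliProduct μ p) (hν : IsBernoulliProduct ν q)
    (hpq : p ≠ q) : ∀ᵐ ω ∂μ, Tendsto (fun t => Dtest μ ν t ω) atTop (nhds 1) := by
  filter_upwards [hμ.ae_bernoulliMass_pos, hμ.ae_tendsto_prod_sqrtRatio hν.2.1 hpq] with ω hpos hω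
  rw [← tendsto_add_atTop_iff_nat 1]
  have hlim : Tendsto (fun t => 1 / (1 + (∏ i ∈ Finset.range t, sqrtRatio p q (ω i)) ^ 2))
      atTop (nhds 1) := by
    have := ((hω.pow 2).const_add 1).inv₀ (by norm_num)
    simpa using this
  refine hlim.congr fun t => ?_
  have hP : 0 < ∏ i ∈ Finset.range t, bernoulliMass p (ω i) := Finset.prod_pos fun i _ => hpos i
  have hratio : ∏ i ∈ Finset.range t, bernoulliMass q (ω i) =
      (∏ i ∈ Finset.range t, sqrtRatio p q (ω i)) ^ 2 *
        ∏ i ∈ Finset.range t, bernoulliMass p (ω i) := by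
    rw [← Finset.prod_pow, ← Finset.prod_mul_distrib]
    refine Finset.prod_congr rfl fun i _ => ?_
    rw [sqrtRatio, Real.sq_sqrt (div_nonneg (bernoulliMass_nonneg hν.2.1 _) (hpos i).le),
      div_mul_cancel₀ _ (hpos i).ne']
  have hsum : 0 < μ (cyl ω t) + ν (cyl ω t) := by
    refine add_pos_of_pos_of_nonneg ?_ zero_le
    rw [hμ.measure_cyl]
    exact ENNReal.ofReal_pos.2 hP
  simp only [Dtest, if_pos hsum, hμ.toReal_measure_cyl, hν.toReal_measure_cyl, hratio]
  field_simp

end IsBernoulliProduct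

lemma Dtest_anonymous : Anonymous Dtest := by
  intro f g _ _ t _ ω
  rcases t with _ | s
  · norm_num [Dtest]
  · simp only [Dtest, add_comm (g (cyl ω s))]
    split_ifs with h
    · have hne : (f (cyl ω s)).toReal + (g (cyl ω s)).toReal ≠ 0 := by
        rw [← ENNReal.toReal_add (measure_ne_top _ _) (measure_ne_top _ _)]
        exact (ENNReal.toReal_pos h.ne'
          (ENNReal.add_ne_top.2 ⟨measure_ne_top _ _, measure_ne_top _ _⟩)).ne'
      rw [add_comm (g (cyl ω s)).toReal, eq_sub_iff_add_eq, ← add_div, div_self hne]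
    · norm_num

lemma IsBernoulliProduct.ae_tendsto_Dtest_zero {μ ν : Measure BinSeq} {p q : ℝ}
    (hμ : IsBernoulliProduct μ p) (hν : IsBernoulliProduct ν q) (hpq : p ≠ q) :
    ∀ᵐ ω ∂ν, Tendsto (fun t => Dtest μ ν t ω) atTop (nhds 0) := by
  filter_upwards [hν.ae_tendsto_Dtest hμ hpq.symm] with ω hω
  have h := hω.const_sub 1
  rw [sub_self] at h
  refine h.congr' ?_
  filter_upwards [eventually_ge_atTop 1] with t ht
  exact (Dtest_anonymous μ ν hμ.1 hν.1 t ht ω).symm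

lemma isPiSystem_cyl : IsPiSystem {s : Set BinSeq | ∃ ω t, s = cyl ω t} := by
  rintro _ ⟨ω₁, t₁, rfl⟩ _ ⟨ω₂, t₂, rfl⟩ ⟨ω, h₁, h₂⟩
  refine ⟨ω, max t₁ t₂, ?_⟩
  rw [← cyl_eq_of_mem h₁, ← cyl_eq_of_mem h₂]
  ext x
  simp only [cyl, mem_inter_iff, mem_ofPred_eq, lt_max_iff]
  exact ⟨fun h i hi => hi.elim (h.1 i) (h.2 i), fun h => ⟨fun i hi => h i (.inl hi),
    fun i hi => h i (.inr hi)⟩⟩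

lemma generateFrom_cyl :
    (inferInstance : MeasurableSpace BinSeq) =
      MeasurableSpace.generateFrom {s : Set BinSeq | ∃ ω t, s = cyl ω t} := by
  refine le_antisymm (iSup_le fun i => ?_) (MeasurableSpace.generateFrom_le ?_)
  · rw [← measurable_iff_comap_le]
    refine measurable_to_bool ?_
    have h : (fun ω : BinSeq => ω i) ⁻¹' {true} =
        ⋃ x : {x : Fin (i + 1) → Bool // x (Fin.last i) = true},
          cyl (extendWord x.1) (i + 1) := by
      ext ω
      simp only [← restrict_preimage_singleton]
      simp [Fin.val_last]
    rw [h]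
    exact .iUnion fun x => MeasurableSpace.measurableSet_generateFrom ⟨_, _, rfl⟩
  · rintro _ ⟨ω, t, rfl⟩
    exact measurableSet_cyl ω t

lemma IsBernoulliProduct.unique {μ ν : Measure BinSeq} {p : ℝ} (hμ : IsBernoulliProduct μ p)
    (hν : IsBernoulliProduct ν p) : μ = ν := by
  have := hμ.1
  have := hν.1
  refine ext_of_generate_finite _ generateFrom_cyl isPiSystem_cyl ?_ (by simp)
  rintro _ ⟨ω, t, rfl⟩
  rw [hμ.measure_cyl, hν.measure_cyl]

lemma measure_eq_one_of_ae {α : Type*} [MeasurableSpace α] {μ : Measure α}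
    [IsProbabilityMeasure μ] {P : α → Prop} (h : ∀ᵐ x ∂μ, P x) : μ {x | P x} = 1 := by
  rw [measure_congr (eventuallyEq_univ.2 h), measure_univ]

lemma idealWrt_Dtest_isBernoulliProduct :
    IdealWrt Dtest {μ : Measure BinSeq | ∃ p : ℝ, IsBernoulliProduct μ p} := by
  rintro f g ⟨p, hf⟩ ⟨q, hg⟩ hfg
  have hpq : p ≠ q := by
    rintro rfl
    exact hfg (hf.unique hg)
  have := hf.1
  have := hg.1
  exact ⟨measure_eq_one_of_ae (hf.ae_tendsto_Dtest hg hpq),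
    measure_eq_one_of_ae (hf.ae_tendsto_Dtest_zero hg hpq)⟩

/-- For two Bernoulli product measures with distinct parameters, the finite derivative test
converges to `1` `f`-a.s. and the set where it converges to `1` is `g`-null; consequently `D`
is ideal with respect to the set of all i.i.d. measures. -/
theorem stmt19 (a b : ℝ) (ha : a ∈ Set.Icc (0:ℝ) 1) (hb : b ∈ Set.Icc (0:ℝ) 1) (hab : a ≠ b)
    (f g : Measure BinSeq) (hf : IsBernoulliProduct f a) (hg : IsBernoulliProduct g b) :
    f {ω | Tendsto (fun t => Dtest f g t ω) atTop (nhds 1)} = 1 ∧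
    g {ω | Tendsto (fun t => Dtest f g t ω) atTop (nhds 1)} = 0 ∧
    IdealWrt Dtest {μ : Measure BinSeq | ∃ p : ℝ, IsBernoulliProduct μ p} := by
  have := hf.1
  refine ⟨measure_eq_one_of_ae (hf.ae_tendsto_Dtest hg hab), ?_,
    idealWrt_Dtest_isBernoulliProduct⟩
  rw [measure_eq_zero_iff_ae_notMem]
  filter_upwards [hf.ae_tendsto_Dtest_zero hg hab] with ω hω h
  exact zero_ne_one (tendsto_nhds_unique hω h)
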